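/- For a positive semi-definite 2×2 matrix K = [[K1, K3],[K3, K2]] and (z1, z2) ~ N(0, K), the expectation E[erf(z1)·erf(z2)] equals (2/π)·arcsin(2K3/√((1 + 2K1)(1 + 2K2))), where erf(x) = (2/√π)∫₀ˣ e^{−t²} dt. -/

import Mathlib

open MeasureTheory ProbabilityTheory Real

/-- The standard Gaussian measure on `ℝ × ℝ`. -/
noncomputable def stdGauss2 : Measure (ℝ × ℝ) :=
  (gaussianReal 0 1).prod (gaussianReal 0 1)

/-- First coordinate of a centered bivariate Gaussian with covariance
`[[K1, K3], [K3, K2]]`, realized from two independent standard Gaussians. -/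
noncomputable def gaussZ1 (K1 : ℝ) (p : ℝ × ℝ) : ℝ := Real.sqrt K1 * p.1

/-- Second coordinate of a centered bivariate Gaussian with covariance
`[[K1, K3], [K3, K2]]`. -/
noncomputable def gaussZ2 (K1 K2 K3 : ℝ) (p : ℝ × ℝ) : ℝ :=
  (K3 / Real.sqrt K1) * p.1 + Real.sqrt (K2 - K3 ^ 2 / K1) * p.2

/-- The Gauss error function `erf x = (2/√π) ∫₀ˣ e^{−t²} dt`. -/
noncomputable def erf (x : ℝ) : ℝ :=
  (2 / Real.sqrt π) * ∫ t in (0:ℝ)..x, Real.exp (-t ^ 2)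

lemma eq_of_same_deriv {f g h : ℝ → ℝ} (hf : ∀ x, HasDerivAt f (h x) x)
    (hg : ∀ x, HasDerivAt g (h x) x) (h0 : f 0 = g 0) (x : ℝ) : f x = g x := by
  have hd : ∀ x, HasDerivAt (fun x => f x - g x) 0 x := fun x => by
    simpa using (hf x).fun_sub (hg x)
  have := is_const_of_deriv_eq_zero (f := fun x => f x - g x)
    (fun x => (hd x).differentiableAt) (fun x => (hd x).deriv) x 0
  linarith

lemma erf_hasDerivAt (x : ℝ) : HasDerivAt erf (2 / Real.sqrt π * Real.exp (-x ^ 2)) x := by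
  unfold erf
  apply HasDerivAt.const_mul
  have hc : Continuous fun t : ℝ => Real.exp (-t ^ 2) := by fun_prop
  exact (hc.integral_hasStrictDerivAt 0 x).hasDerivAt

lemma erf_continuous : Continuous erf :=
  continuous_iff_continuousAt.2 fun x => (erf_hasDerivAt x).continuousAt

lemma erf_zero : erf 0 = 0 := by simp [erf]

lemma erf_neg (x : ℝ) : erf (-x) = - erf x := by
  have := intervalIntegral.integral_comp_neg (a := 0) (b := x) (fun t : ℝ => Real.exp (-t ^ 2))
  simp only [neg_sq, neg_zero] at this
  unfold erf
  rw [this, intervalIntegral.integral_symm]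
  simp

lemma erf_bound (x : ℝ) : |erf x| ≤ 2 := by
  have hpi : 0 < Real.sqrt π := Real.sqrt_pos.2 Real.pi_pos
  have hi : Integrable fun t : ℝ => Real.exp (-t ^ 2) := by
    simpa using integrable_exp_neg_mul_sq (b := 1) one_pos
  have h2 : ∫ t : ℝ, Real.exp (-t ^ 2) = Real.sqrt π := by
    simpa using integral_gaussian 1
  have h1 : |∫ t in (0:ℝ)..x, Real.exp (-t ^ 2)| ≤ Real.sqrt π := by
    rw [← h2]
    refine (intervalIntegral.norm_integral_le_integral_norm_uIoc
      (f := fun t : ℝ => Real.exp (-t ^ 2)) (μ := volume) (a := 0) (b := x)).trans ?_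
    simp only [Real.norm_eq_abs, Real.abs_exp]
    exact setIntegral_le_integral hi (Filter.Eventually.of_forall fun t => (Real.exp_pos _).le)
  unfold erf
  rw [abs_mul, abs_of_pos (by positivity)]
  calc 2 / Real.sqrt π * |∫ t in (0:ℝ)..x, Real.exp (-t ^ 2)|
      ≤ 2 / Real.sqrt π * Real.sqrt π := by gcongr
    _ = 2 := by field_simp

lemma integral_gauss01 (f : ℝ → ℝ) :
    ∫ x, f x ∂(gaussianReal 0 1) = (Real.sqrt (2 * π))⁻¹ * ∫ x, f x * Real.exp (-x ^ 2 / 2) := by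
  rw [integral_gaussianReal_eq_integral_smul (by norm_num), ← integral_const_mul]
  congr 1
  ext x
  simp [gaussianPDFReal]
  ring

lemma integrable_pow_gauss (n : ℕ) : Integrable (fun x : ℝ => |x| ^ n) (gaussianReal 0 1) := by
  have := (memLp_id_gaussianReal (μ := 0) (v := 1) n).integrable_norm_pow'
  simpa using this

/-- `E exp(-(m+cy)²)` -/
lemma E_exp_shift (m c : ℝ) : ∫ y, Real.exp (-(m + c * y) ^ 2) ∂(gaussianReal 0 1) =
    (Real.sqrt (1 + 2 * c ^ 2))⁻¹ * Real.exp (-(m / Real.sqrt (1 + 2 * c ^ 2)) ^ 2) := by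
  have hpos : 0 < 1 + 2 * c ^ 2 := by positivity
  rw [integral_gauss01]
  have : ∀ y : ℝ, Real.exp (-(m + c * y) ^ 2) * Real.exp (-y ^ 2 / 2) =
      Real.exp (-(m / Real.sqrt (1 + 2 * c ^ 2)) ^ 2) *
        Real.exp (-((1 + 2 * c ^ 2) / 2) * (y + 2 * m * c / (1 + 2 * c ^ 2)) ^ 2) := fun y => by
    rw [← Real.exp_add, ← Real.exp_add, div_pow, Real.sq_sqrt hpos.le]
    congr 1
    field_simp
    ring
  simp_rw [this]
  rw [integral_const_mul, integral_add_right_eq_self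
    (fun y : ℝ => Real.exp (-((1 + 2 * c ^ 2) / 2) * y ^ 2)), integral_gaussian]
  have e : π / ((1 + 2 * c ^ 2) / 2) = (2 * π) / (1 + 2 * c ^ 2) := by field_simp
  rw [e, Real.sqrt_div (by positivity)]
  have : 0 < Real.sqrt (2 * π) := Real.sqrt_pos.2 (by positivity)
  field_simp

/-- `E x² exp(-r x²)` -/
lemma E_sq_exp (r : ℝ) (hr : 0 ≤ r) : ∫ x, x ^ 2 * Real.exp (-r * x ^ 2) ∂(gaussianReal 0 1) =
    (Real.sqrt (1 + 2 * r) ^ 3)⁻¹ := by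
  have hpos : 0 < 1 + 2 * r := by positivity
  rw [integral_gauss01]
  let v : NNReal := ⟨(1 + 2 * r)⁻¹, by positivity⟩
  have hv : (v : ℝ) = (1 + 2 * r)⁻¹ := rfl
  have hv0 : v ≠ 0 := by
    intro h
    have : (v : ℝ) = 0 := by rw [h]; rfl
    rw [hv] at this
    have : 0 < (1 + 2 * r)⁻¹ := by positivity
    linarith
  have h1 : ∫ x, x ^ 2 ∂(gaussianReal 0 v) = v := by
    have := variance_id_gaussianReal (μ := 0) (v := v)
    rw [variance_eq_integral (by fun_prop)] at this
    simpa using this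
  rw [integral_gaussianReal_eq_integral_smul hv0] at h1
  have h2 : ∀ x : ℝ, gaussianPDFReal 0 v x • x ^ 2 = (Real.sqrt (2 * π) )⁻¹ * Real.sqrt (1 + 2 * r) *
      (x ^ 2 * Real.exp (-r * x ^ 2) * Real.exp (-x ^ 2 / 2)) := fun x => by
    rw [gaussianPDFReal, hv, mul_assoc (x ^ 2), ← Real.exp_add, Real.sqrt_mul (by positivity),
      Real.sqrt_inv, smul_eq_mul]
    have : -(x - 0) ^ 2 / (2 * (1 + 2 * r)⁻¹) = -r * x ^ 2 + -x ^ 2 / 2 := by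
      field_simp
      ring
    rw [this]
    have : 0 < Real.sqrt (1 + 2 * r) := Real.sqrt_pos.2 hpos
    field_simp
  simp_rw [h2] at h1
  rw [integral_const_mul, hv] at h1
  have hs : 0 < Real.sqrt (1 + 2 * r) := Real.sqrt_pos.2 hpos
  have hss : Real.sqrt (1 + 2 * r) ^ 2 = 1 + 2 * r := Real.sq_sqrt hpos.le
  rw [← hss] at h1
  rw [Real.sqrt_sq hs.le] at h1
  set s := Real.sqrt (1 + 2 * r)
  have : s ^ 3 = s * s ^ 2 := by ring
  rw [this, mul_inv, ← h1]
  generalize (∫ x : ℝ, x ^ 2 * Real.exp (-r * x ^ 2) * Real.exp (-x ^ 2 / 2)) = I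
  field_simp

lemma E_erf_shift (m c : ℝ) : ∫ y, erf (m + c * y) ∂(gaussianReal 0 1) =
    erf (m / Real.sqrt (1 + 2 * c ^ 2)) := by
  refine eq_of_same_deriv (f := fun m => ∫ y, erf (m + c * y) ∂(gaussianReal 0 1))
    (g := fun m => erf (m / Real.sqrt (1 + 2 * c ^ 2)))
    (h := fun m => 2 / Real.sqrt π * ((Real.sqrt (1 + 2 * c ^ 2))⁻¹ *
      Real.exp (-(m / Real.sqrt (1 + 2 * c ^ 2)) ^ 2))) ?_ ?_ ?_ m
  · intro m
    rw [← E_exp_shift, ← integral_const_mul]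
    refine (hasDerivAt_integral_of_dominated_loc_of_deriv_le (s := Set.univ)
      (F := fun m y => erf (m + c * y))
      (F' := fun m y => 2 / Real.sqrt π * Real.exp (-(m + c * y) ^ 2))
      (bound := fun _ => 2 / Real.sqrt π) Filter.univ_mem ?_ ?_ ?_ ?_ ?_ ?_).2
    · exact Filter.Eventually.of_forall fun m =>
        (erf_continuous.comp (by fun_prop)).aestronglyMeasurable
    · exact Integrable.of_bound (erf_continuous.comp (by fun_prop)).aestronglyMeasurable 2
        (Filter.Eventually.of_forall fun y => erf_bound _)
    · exact Continuous.aestronglyMeasurable (by fun_prop)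
    · refine Filter.Eventually.of_forall fun y m _ => ?_
      rw [Real.norm_eq_abs, abs_of_nonneg (by positivity)]
      exact mul_le_of_le_one_right (by positivity) (Real.exp_le_one_iff.2 (by nlinarith [sq_nonneg (m + c * y)]))
    · exact integrable_const _
    · refine Filter.Eventually.of_forall fun y m _ => ?_
      have := (erf_hasDerivAt (m + c * y)).comp m ((hasDerivAt_id m).add_const (c * y))
      refine this.congr_deriv ?_
      ring
  · intro m
    have := (erf_hasDerivAt (m / Real.sqrt (1 + 2 * c ^ 2))).comp m
      ((hasDerivAt_id m).div_const (Real.sqrt (1 + 2 * c ^ 2)))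
    refine this.congr_deriv ?_
    simp
    ring
  · simp only [zero_add, zero_div, erf_zero]
    rw [integral_gauss01]
    have := integral_neg_eq_self (fun y : ℝ => erf (c * y) * Real.exp (-y ^ 2 / 2)) volume
    simp only [mul_neg, erf_neg, neg_sq, neg_mul, integral_neg] at this
    have : ∫ y : ℝ, erf (c * y) * Real.exp (-y ^ 2 / 2) = 0 := by linarith
    rw [this, mul_zero]

/-- `E[x erf(ax) exp(-β²x²)]` -/
lemma E_H (a b : ℝ) : ∫ x, erf (a * x) * (x * Real.exp (-(b * x) ^ 2)) ∂(gaussianReal 0 1) =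
    2 / Real.sqrt π * (a / ((1 + 2 * b ^ 2) * Real.sqrt (1 + 2 * (a ^ 2 + b ^ 2)))) := by
  refine eq_of_same_deriv
    (f := fun a => ∫ x, erf (a * x) * (x * Real.exp (-(b * x) ^ 2)) ∂(gaussianReal 0 1))
    (g := fun a => 2 / Real.sqrt π * (a / ((1 + 2 * b ^ 2) * Real.sqrt (1 + 2 * (a ^ 2 + b ^ 2)))))
    (h := fun a => 2 / Real.sqrt π * (Real.sqrt (1 + 2 * (a ^ 2 + b ^ 2)) ^ 3)⁻¹) ?_ ?_ ?_ a
  · intro a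
    rw [← E_sq_exp _ (by positivity), ← integral_const_mul]
    refine (hasDerivAt_integral_of_dominated_loc_of_deriv_le (s := Set.univ)
      (F := fun a x => erf (a * x) * (x * Real.exp (-(b * x) ^ 2)))
      (F' := fun a x => 2 / Real.sqrt π * (x ^ 2 * Real.exp (-(a ^ 2 + b ^ 2) * x ^ 2)))
      (bound := fun x => 2 / Real.sqrt π * |x| ^ 2) Filter.univ_mem ?_ ?_ ?_ ?_ ?_ ?_).2
    · exact Filter.Eventually.of_forall fun m =>
        ((erf_continuous.comp (by fun_prop)).mul (by fun_prop)).aestronglyMeasurable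
    · refine Integrable.mono' ((integrable_pow_gauss 1).const_mul 2)
        ((erf_continuous.comp (by fun_prop)).mul (by fun_prop)).aestronglyMeasurable
        (Filter.Eventually.of_forall fun x => ?_)
      rw [norm_mul, norm_mul, Real.norm_eq_abs, Real.norm_eq_abs, Real.norm_eq_abs, Real.abs_exp,
        pow_one]
      have h1 : Real.exp (-(b * x) ^ 2) ≤ 1 :=
        Real.exp_le_one_iff.2 (by nlinarith [sq_nonneg (b * x)])
      exact mul_le_mul (erf_bound _) (mul_le_of_le_one_right (abs_nonneg _) h1)
        (by positivity) (by norm_num)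
    · exact Continuous.aestronglyMeasurable (by fun_prop)
    · refine Filter.Eventually.of_forall fun x a _ => ?_
      rw [Real.norm_eq_abs, abs_of_nonneg (by positivity), sq_abs]
      gcongr
      refine mul_le_of_le_one_right (by positivity) (Real.exp_le_one_iff.2 ?_)
      have : 0 ≤ (a ^ 2 + b ^ 2) * x ^ 2 := by positivity
      linarith
    · exact (integrable_pow_gauss 2).const_mul _
    · refine Filter.Eventually.of_forall fun x a _ => ?_
      have := ((erf_hasDerivAt (a * x)).comp a ((hasDerivAt_id a).mul_const x)).mul_const
        (x * Real.exp (-(b * x) ^ 2))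
      refine this.congr_deriv ?_
      have e : -(a ^ 2 + b ^ 2) * x ^ 2 = -(a * x) ^ 2 + -(b * x) ^ 2 := by ring
      rw [e, Real.exp_add]
      ring
  · intro a
    have hpos : 0 < 1 + 2 * (a ^ 2 + b ^ 2) := by positivity
    have hs : 0 < Real.sqrt (1 + 2 * (a ^ 2 + b ^ 2)) := Real.sqrt_pos.2 hpos
    have hss := Real.sq_sqrt hpos.le
    have hb : 0 < 1 + 2 * b ^ 2 := by positivity
    have d1 : HasDerivAt (fun a : ℝ => 1 + 2 * (a ^ 2 + b ^ 2)) (4 * a) a := by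
      have := ((((hasDerivAt_id a).pow 2).add_const (b ^ 2)).const_mul 2).const_add 1
      refine this.congr_deriv ?_
      simp
      ring
    have d2 := ((hasDerivAt_id a).div ((d1.sqrt hpos.ne').const_mul (1 + 2 * b ^ 2))
      (by positivity)).const_mul (2 / Real.sqrt π)
    refine d2.congr_deriv ?_
    simp only [id]
    congr 1
    set s := Real.sqrt (1 + 2 * (a ^ 2 + b ^ 2))
    have e : 1 + 2 * b ^ 2 = s ^ 2 - 2 * a ^ 2 := by linarith
    rw [e] at hb ⊢
    field_simp
    ring
  · simp [erf_zero]

lemma E_erf_erf (a b : ℝ) : ∫ x, erf (a * x) * erf (b * x) ∂(gaussianReal 0 1) =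
    2 / π * Real.arctan (2 * a * b / Real.sqrt (1 + 2 * (a ^ 2 + b ^ 2))) := by
  have hpi : Real.sqrt π * Real.sqrt π = π := Real.mul_self_sqrt Real.pi_pos.le
  refine eq_of_same_deriv
    (f := fun b => ∫ x, erf (a * x) * erf (b * x) ∂(gaussianReal 0 1))
    (g := fun b => 2 / π * Real.arctan (2 * a * b / Real.sqrt (1 + 2 * (a ^ 2 + b ^ 2))))
    (h := fun b => 2 / Real.sqrt π * (2 / Real.sqrt π *
      (a / ((1 + 2 * b ^ 2) * Real.sqrt (1 + 2 * (a ^ 2 + b ^ 2)))))) ?_ ?_ ?_ b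
  · intro b
    rw [← E_H, ← integral_const_mul]
    refine (hasDerivAt_integral_of_dominated_loc_of_deriv_le (s := Set.univ)
      (F := fun b x => erf (a * x) * erf (b * x))
      (F' := fun b x => 2 / Real.sqrt π * (erf (a * x) * (x * Real.exp (-(b * x) ^ 2))))
      (bound := fun x => 2 / Real.sqrt π * (2 * |x| ^ 1)) Filter.univ_mem ?_ ?_ ?_ ?_ ?_ ?_).2
    · exact Filter.Eventually.of_forall fun m =>
        ((erf_continuous.comp (by fun_prop)).mul
          (erf_continuous.comp (by fun_prop))).aestronglyMeasurable
    · refine Integrable.of_bound ((erf_continuous.comp (by fun_prop)).mul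
          (erf_continuous.comp (by fun_prop))).aestronglyMeasurable (2 * 2)
        (Filter.Eventually.of_forall fun x => ?_)
      rw [norm_mul]
      exact mul_le_mul (erf_bound _) (erf_bound _) (norm_nonneg _) (by norm_num)
    · exact (continuous_const.mul ((erf_continuous.comp (by fun_prop)).mul
        (by fun_prop))).aestronglyMeasurable
    · refine Filter.Eventually.of_forall fun x b _ => ?_
      rw [norm_mul, norm_mul, norm_mul, Real.norm_eq_abs, Real.norm_eq_abs, Real.norm_eq_abs,
        Real.norm_eq_abs, Real.abs_exp, pow_one, abs_of_nonneg (by positivity)]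
      have h1 : Real.exp (-(b * x) ^ 2) ≤ 1 :=
        Real.exp_le_one_iff.2 (by nlinarith [sq_nonneg (b * x)])
      refine mul_le_mul_of_nonneg_left ?_ (by positivity)
      exact mul_le_mul (erf_bound _) (mul_le_of_le_one_right (abs_nonneg _) h1)
        (by positivity) (by norm_num)
    · exact ((integrable_pow_gauss 1).const_mul _).const_mul _
    · refine Filter.Eventually.of_forall fun x b _ => ?_
      have := ((erf_hasDerivAt (b * x)).comp b ((hasDerivAt_id b).mul_const x)).const_mul
        (erf (a * x))
      refine this.congr_deriv ?_
      ring
  · intro b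
    have hpos : 0 < 1 + 2 * (a ^ 2 + b ^ 2) := by positivity
    have hs : 0 < Real.sqrt (1 + 2 * (a ^ 2 + b ^ 2)) := Real.sqrt_pos.2 hpos
    have hss := Real.sq_sqrt hpos.le
    have hb : 0 < 1 + 2 * b ^ 2 := by positivity
    have d1 : HasDerivAt (fun b : ℝ => 1 + 2 * (a ^ 2 + b ^ 2)) (4 * b) b := by
      have := ((((hasDerivAt_id b).pow 2).const_add (a ^ 2)).const_mul 2).const_add 1
      refine this.congr_deriv ?_
      simp
      ring
    have d2 := ((((hasDerivAt_id b).const_mul (2 * a)).div (d1.sqrt hpos.ne')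
      hs.ne').arctan).const_mul (2 / π)
    refine d2.congr_deriv ?_
    simp only [id, Pi.div_apply]
    set s := Real.sqrt (1 + 2 * (a ^ 2 + b ^ 2))
    have ha : 0 < 1 + 2 * a ^ 2 := by positivity
    have e : 1 + (2 * a * b / s) ^ 2 = (1 + 2 * a ^ 2) * (1 + 2 * b ^ 2) / s ^ 2 := by
      field_simp
      rw [hss]
      ring
    have e2 : (2 * a * 1 * s - 2 * a * b * (4 * b / (2 * s))) / s ^ 2 =
        2 * a * (1 + 2 * a ^ 2) / s ^ 3 := by
      field_simp
      rw [hss]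
      ring
    rw [e, e2]
    have hp := Real.pi_pos
    have : 2 / Real.sqrt π * (2 / Real.sqrt π * (a / ((1 + 2 * b ^ 2) * s))) =
      4 / (Real.sqrt π * Real.sqrt π) * (a / ((1 + 2 * b ^ 2) * s)) := by
      field_simp
      ring
    rw [this, hpi]
    field_simp
    ring
  · simp [erf_zero]

/-- For a PSD 2×2 covariance `K = [[K1,K3],[K3,K2]]` and `(z1, z2) ∼ N(0, K)`,
`E[erf(z1) · erf(z2)] = (2/π) arcsin(2K3/√((1+2K1)(1+2K2)))`. -/
theorem rntk_Vphi_erf (K1 K2 K3 : ℝ) (hK1 : 0 ≤ K1) (hK2 : 0 ≤ K2)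
    (hPSD : K3 ^ 2 ≤ K1 * K2) :
    ∫ p, erf (gaussZ1 K1 p) * erf (gaussZ2 K1 K2 K3 p) ∂stdGauss2 =
      (2 / π) * Real.arcsin (2 * K3 / Real.sqrt ((1 + 2 * K1) * (1 + 2 * K2))) := by
  rcases hK1.eq_or_lt with h | hpos
  · subst h
    have h3 : K3 = 0 := by
      have : K3 ^ 2 ≤ 0 := by simpa using hPSD
      exact pow_eq_zero_iff (two_ne_zero) |>.1 (le_antisymm this (sq_nonneg _))
    subst h3
    simp [gaussZ1, erf_zero]
  have hc0 : 0 ≤ K2 - K3 ^ 2 / K1 := by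
    rw [sub_nonneg, div_le_iff₀ hpos]
    linarith
  unfold gaussZ1 gaussZ2 stdGauss2
  have ha : 0 < Real.sqrt K1 := Real.sqrt_pos.2 hpos
  have haa : Real.sqrt K1 ^ 2 = K1 := Real.sq_sqrt hK1
  have hcc : Real.sqrt (K2 - K3 ^ 2 / K1) ^ 2 = K2 - K3 ^ 2 / K1 := Real.sq_sqrt hc0
  set a := Real.sqrt K1
  set c := Real.sqrt (K2 - K3 ^ 2 / K1)
  rw [integral_prod]
  swap
  · refine Integrable.of_bound ((erf_continuous.comp (by fun_prop)).mul
          (erf_continuous.comp (by fun_prop))).aestronglyMeasurable (2 * 2)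
        (Filter.Eventually.of_forall fun x => ?_)
    rw [norm_mul]
    exact mul_le_mul (erf_bound _) (erf_bound _) (norm_nonneg _) (by norm_num)
  simp only [integral_const_mul, E_erf_shift]
  have hS : 0 < 1 + 2 * c ^ 2 := by positivity
  have hs : 0 < Real.sqrt (1 + 2 * c ^ 2) := Real.sqrt_pos.2 hS
  have hss : Real.sqrt (1 + 2 * c ^ 2) ^ 2 = 1 + 2 * c ^ 2 := Real.sq_sqrt hS.le
  set s := Real.sqrt (1 + 2 * c ^ 2)
  have h1 : ∀ x : ℝ, K3 / a * x / s = (K3 / a / s) * x := fun x => by ring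
  simp_rw [h1]
  rw [E_erf_erf, Real.arctan_eq_arcsin]
  congr 2
  set b := K3 / a / s with hb
  have hab : 2 * a * b = 2 * K3 / s := by
    rw [hb]
    field_simp
  have hT : 0 < 1 + 2 * (a ^ 2 + b ^ 2) := by positivity
  have ht : 0 < Real.sqrt (1 + 2 * (a ^ 2 + b ^ 2)) := Real.sqrt_pos.2 hT
  have key : (1 + 2 * K1) * (1 + 2 * K2) =
      s ^ 2 * ((1 + 2 * (a ^ 2 + b ^ 2)) *
        (1 + (2 * a * b / Real.sqrt (1 + 2 * (a ^ 2 + b ^ 2))) ^ 2)) := by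
    rw [div_pow (2 * a * b), Real.sq_sqrt hT.le]
    have hk2 : K2 = c ^ 2 + K3 ^ 2 / K1 := by linarith
    have hbb : b ^ 2 = K3 ^ 2 / K1 / s ^ 2 := by
      rw [hb, div_pow, div_pow, haa]
    have : s ^ 2 * ((1 + 2 * (a ^ 2 + b ^ 2)) *
        (1 + (2 * a * b) ^ 2 / (1 + 2 * (a ^ 2 + b ^ 2)))) =
        (1 + 2 * a ^ 2) * (s ^ 2 + 2 * (s ^ 2 * b ^ 2)) := by
      field_simp
      ring
    rw [this, hbb, mul_div_cancel₀ _ (by positivity), hss, haa, hk2]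
    ring
  rw [key, Real.sqrt_mul (by positivity), Real.sqrt_mul hT.le, Real.sqrt_sq hs.le, hab]
  have : 0 < Real.sqrt (1 + (2 * K3 / s / Real.sqrt (1 + 2 * (a ^ 2 + b ^ 2))) ^ 2) :=
    Real.sqrt_pos.2 (by positivity)
  field_simp
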